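/- A quaternion k-algebra Q is split by L (i.e. Q ⊗_k L is isomorphic as an L-algebra to the 2×2 matrix algebra over L) if and only if there exists λ ∈ k^× with ρ(λ) ≠ 0 such that Q is isomorphic as a k-algebra to the quaternion algebra (λ, −ρ(λ))_k. -/

import Mathlib

open scoped Quaternion TensorProduct
open Polynomial

namespace S17

theorem re_eq_zero_of_ker {k : Type} [Field k] (h2 : (2 : k) ≠ 0) {a b : k} (ha : a ≠ 0) (hb : b ≠ 0)
    {A : Type} [Ring A] [Algebra k A] [Nontrivial A] (F : ℍ[k, a, b] →ₐ[k] A)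
    (h : ℍ[k, a, b]) (hF : F h = 0) : h.re = 0 := by
  let i : ℍ[k, a, b] := ⟨0, 1, 0, 0⟩
  let j : ℍ[k, a, b] := ⟨0, 0, 1, 0⟩
  have h1 : b • (a • h + i * h * i) + j * (a • h + i * h * i) * j
      = algebraMap k _ (2 * 2 * a * b * h.re) := by
    rw [QuaternionAlgebra.algebraMap_eq]
    ext <;> simp [i, j] <;> ring
  have h4 : (2 * 2 * a * b * h.re) = 0 := by
    apply (algebraMap k A).injective
    rw [← F.commutes, ← h1, map_zero]
    simp only [map_add, map_mul, map_smul, hF]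
    simp
  simpa [ha, hb, h2] using h4

theorem iso_of_basis {k : Type} [Field k] (h2 : (2 : k) ≠ 0) {a b : k} (ha : a ≠ 0) (hb : b ≠ 0)
    {A : Type} [Ring A] [Algebra k A] [Nontrivial A] [Module.Finite k A]
    (hd : Module.finrank k A = 4) (I J : A) (hI : I * I = a • 1) (hJ : J * J = b • 1)
    (hIJ : J * I = - (I * J)) : Nonempty (ℍ[k, a, b] ≃ₐ[k] A) := by
  let B : QuaternionAlgebra.Basis A a 0 b :=
    { i := I, j := J, k := I * J, i_mul_i := by simp [hI], j_mul_j := hJ, i_mul_j := rfl,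
      j_mul_i := by simp [hIJ] }
  let F := B.liftHom
  have hinj : Function.Injective F := by
    rw [injective_iff_map_eq_zero]
    intro h hF
    have e0 := re_eq_zero_of_ker h2 ha hb F h hF
    have e1 := re_eq_zero_of_ker h2 ha hb F (h * ⟨0, 1, 0, 0⟩) (by rw [map_mul, hF, zero_mul])
    have e2 := re_eq_zero_of_ker h2 ha hb F (h * ⟨0, 0, 1, 0⟩) (by rw [map_mul, hF, zero_mul])
    have e3 := re_eq_zero_of_ker h2 ha hb F (h * ⟨0, 0, 0, 1⟩) (by rw [map_mul, hF, zero_mul])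
    simp [ha, hb] at e1 e2 e3
    ext <;> simp [*]
  have hdim : Module.finrank k ℍ[k, a, b] = Module.finrank k A := by
    rw [hd, QuaternionAlgebra.finrank_eq_four]
  have hbij : Function.Bijective F :=
    ⟨hinj, (LinearMap.injective_iff_surjective_of_finrank_eq_finrank
      (f := F.toLinearMap) hdim).1 hinj⟩
  exact ⟨AlgEquiv.ofBijective F hbij⟩

theorem iso_matrix {k : Type} [Field k] (h2 : (2 : k) ≠ 0) {a b : k} (ha : a ≠ 0) (hb : b ≠ 0)
    (A B : k) (h : b = A ^ 2 - a * B ^ 2) :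
    Nonempty (ℍ[k, a, b] ≃ₐ[k] Matrix (Fin 2) (Fin 2) k) := by
  refine iso_of_basis h2 ha hb (by simp [Module.finrank_matrix]) !![0, a; 1, 0] !![A, -a * B; B, -A] ?_ ?_ ?_
  · ext i j; fin_cases i <;> fin_cases j <;> simp
  · ext i j; fin_cases i <;> fin_cases j <;> simp [h] <;> ring
  · ext i j; fin_cases i <;> fin_cases j <;> simp <;> ring

theorem baseChange {k : Type} [Field k] (L : Type) [Field L] [Algebra k L] (a b : k) :
    Nonempty ((L ⊗[k] ℍ[k, a, b]) ≃ₐ[L] ℍ[L, algebraMap k L a, algebraMap k L b]) := by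
  let B : QuaternionAlgebra.Basis ℍ[L, algebraMap k L a, algebraMap k L b] a 0 b :=
    { i := ⟨0, 1, 0, 0⟩, j := ⟨0, 0, 1, 0⟩, k := ⟨0, 0, 0, 1⟩
      i_mul_i := by ext <;> simp [Algebra.algebraMap_eq_smul_one]
      j_mul_j := by ext <;> simp [Algebra.algebraMap_eq_smul_one]
      i_mul_j := by ext <;> simp
      j_mul_i := by ext <;> simp }
  let F : (L ⊗[k] ℍ[k, a, b]) →ₐ[L] ℍ[L, algebraMap k L a, algebraMap k L b] :=
    Algebra.TensorProduct.lift (Algebra.ofId L _) B.liftHom (fun x y => Algebra.commutes x _)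
  have hsurj : Function.Surjective F := by
    intro h
    refine ⟨h.re ⊗ₜ 1 + h.imI ⊗ₜ ⟨0, 1, 0, 0⟩ + h.imJ ⊗ₜ ⟨0, 0, 1, 0⟩ + h.imK ⊗ₜ ⟨0, 0, 0, 1⟩, ?_⟩
    have hF : ∀ x y, F (x ⊗ₜ y) = x • B.liftHom y := fun x y => by
      rw [Algebra.smul_def]; exact Algebra.TensorProduct.lift_tmul ..
    rw [map_add, map_add, map_add, hF, hF, hF, hF]
    ext <;> simp [B, QuaternionAlgebra.Basis.lift]
  have hdim : Module.finrank L (L ⊗[k] ℍ[k, a, b]) =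
      Module.finrank L ℍ[L, algebraMap k L a, algebraMap k L b] := by
    rw [Module.finrank_baseChange, QuaternionAlgebra.finrank_eq_four, QuaternionAlgebra.finrank_eq_four]
  have hbij : Function.Bijective F :=
    ⟨(LinearMap.injective_iff_surjective_of_finrank_eq_finrank
      (f := F.toLinearMap) hdim).2 hsurj, hsurj⟩
  exact ⟨AlgEquiv.ofBijective F hbij⟩

/-- Square zero elements. -/
theorem split_isotropic {k : Type} [Field k] {a b : k}
    (e : Nonempty (ℍ[k, a, b] ≃ₐ[k] Matrix (Fin 2) (Fin 2) k)) :
    ∃ h : ℍ[k, a, b], h * h = 0 ∧ h ≠ 0 := by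
  obtain ⟨e⟩ := e
  refine ⟨e.symm !![0, 1; 0, 0], ?_, ?_⟩
  · rw [← map_mul]
    convert map_zero e.symm
    ext i j; fin_cases i <;> fin_cases j <;> simp
  · intro h
    rw [EmbeddingLike.map_eq_zero_iff] at h
    simpa using congrFun (congrFun h 0) 1

/-- A square zero element is pure. -/
theorem sq_zero_coords {k : Type} [Field k] (h2 : (2 : k) ≠ 0) {a b : k}
    (h : ℍ[k, a, b]) (hh : h * h = 0) :
    h.re = 0 ∧ a * h.imI ^ 2 + b * h.imJ ^ 2 - a * b * h.imK ^ 2 = 0 := by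
  have e0 := congrArg QuaternionAlgebra.re hh
  have e1 := congrArg QuaternionAlgebra.imI hh
  have e2 := congrArg QuaternionAlgebra.imJ hh
  have e3 := congrArg QuaternionAlgebra.imK hh
  simp at e0 e1 e2 e3
  have hre : h.re = 0 := by
    by_contra hr
    have f1 : h.imI = 0 := by
      have : 2 * (h.re * h.imI) = 0 := by linear_combination e1
      simpa [h2, hr] using this
    have f2 : h.imJ = 0 := by
      have : 2 * (h.re * h.imJ) = 0 := by linear_combination e2
      simpa [h2, hr] using this
    have f3 : h.imK = 0 := by
      have : 2 * (h.re * h.imK) = 0 := by linear_combination e3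
      simpa [h2, hr] using this
    simp [f1, f2, f3, hr] at e0
  refine ⟨hre, ?_⟩
  rw [hre] at e0
  linear_combination e0

theorem split_of_isotropic {k : Type} [Field k] (h2 : (2 : k) ≠ 0) {a b : k} (ha : a ≠ 0) (hb : b ≠ 0)
    (h : ℍ[k, a, b]) (hh : h * h = 0) (h0 : h ≠ 0) :
    Nonempty (ℍ[k, a, b] ≃ₐ[k] Matrix (Fin 2) (Fin 2) k) := by
  obtain ⟨hre, hq⟩ := sq_zero_coords h2 h hh
  by_cases hn : h.imJ ^ 2 - a * h.imK ^ 2 = 0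
  · have hI : h.imI = 0 := by
      have : a * h.imI ^ 2 = 0 := by linear_combination hq - b * hn
      simpa [ha] using this
    have hK : h.imK ≠ 0 := by
      intro hK
      apply h0
      rw [hK] at hn
      have hJ : h.imJ = 0 := by simpa using hn
      ext <;> simp [*]
    refine iso_matrix h2 ha hb ((b + 1) / 2) ((b - 1) / 2 * h.imK / h.imJ) ?_
    have hJ : h.imJ ≠ 0 := by
      intro hJ
      rw [hJ] at hn
      simp [ha, hK] at hn
    field_simp
    linear_combination -(b - 1) ^ 2 * hn
  · refine iso_matrix h2 ha hb (a * h.imI * h.imK / (h.imJ ^ 2 - a * h.imK ^ 2))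
      (h.imI * h.imJ / (h.imJ ^ 2 - a * h.imK ^ 2)) ?_
    field_simp
    linear_combination (h.imJ ^ 2 - a * h.imK ^ 2) * hq

theorem triple {k : Type} [Field k] (h2 : (2 : k) ≠ 0)
    {A : Type} [Ring A] [Algebra k A] [Nontrivial A] [Module.Finite k A]
    (hd : Module.finrank k A = 4) (u v w : A) (c lam R : k) (hc : c ≠ 0) (hl : lam ≠ 0)
    (hR : R ≠ 0)
    (hu : u * u = (-lam * c) • 1) (hv : v * v = c • 1) (hw : w * w = (-(c * R) / (2 * 2 * lam)) • 1)
    (huv : v * u = -(u * v)) (huw : w * u = -(u * w)) (hvw : w * v = -(v * w)) :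
    Nonempty (ℍ[k, lam, -R] ≃ₐ[k] A) := by
  have key : ∀ s t : A, s * u = -(u * s) → (u * s) * (u * t) = (lam * c) • (s * t) := by
    intro s t hs
    calc (u * s) * (u * t) = u * (s * u) * t := by noncomm_ring
      _ = -((u * u) * (s * t)) := by rw [hs]; noncomm_ring
      _ = _ := by rw [hu, smul_mul_assoc, one_mul, ← neg_smul]; congr 1; ring
  refine iso_of_basis h2 hl (neg_ne_zero.2 hR) hd (c⁻¹ • (u * v)) ((2 * c⁻¹) • (u * w)) ?_ ?_ ?_
  · rw [smul_mul_smul_comm, key _ _ huv, hv, smul_smul, smul_smul]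
    congr 1; field_simp
  · rw [smul_mul_smul_comm, key _ _ huw, hw, smul_smul, smul_smul]
    congr 1; field_simp
  · rw [smul_mul_smul_comm, key _ _ huw, smul_mul_smul_comm, key _ _ huv, hvw, smul_neg, smul_neg,
      mul_comm]

theorem pure_sq {k : Type} [Field k] {a b : k} (u1 u2 u3 : k) :
    (⟨0, u1, u2, u3⟩ : ℍ[k, a, b]) * ⟨0, u1, u2, u3⟩ =
      (a * u1 ^ 2 + b * u2 ^ 2 - a * b * u3 ^ 2) • 1 := by
  ext <;> simp <;> ring

theorem pure_anti {k : Type} [Field k] {a b : k} (u1 u2 u3 w1 w2 w3 : k)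
    (h : a * u1 * w1 + b * u2 * w2 - a * b * u3 * w3 = 0) :
    (⟨0, u1, u2, u3⟩ : ℍ[k, a, b]) * ⟨0, w1, w2, w3⟩ =
      -((⟨0, w1, w2, w3⟩ : ℍ[k, a, b]) * ⟨0, u1, u2, u3⟩) := by
  ext
  · simp
    linear_combination 2 * h
  all_goals simp
  all_goals ring

theorem aniso_coords {k : Type} [Field k] {a b : k} (hA : ∀ h : ℍ[k, a, b], h * h = 0 → h = 0)
    (u1 u2 u3 : k) (h : a * u1 ^ 2 + b * u2 ^ 2 - a * b * u3 ^ 2 = 0) : u1 = 0 ∧ u2 = 0 ∧ u3 = 0 := by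
  have := hA ⟨0, u1, u2, u3⟩ (by rw [pure_sq, h, zero_smul])
  exact ⟨congrArg QuaternionAlgebra.imI this, congrArg QuaternionAlgebra.imJ this,
    congrArg QuaternionAlgebra.imK this⟩

/-- the final step -/
theorem final_step {k : Type} [Field k] (h2 : (2 : k) ≠ 0) {a b : k}
    (hA : ∀ h : ℍ[k, a, b], h * h = 0 → h = 0) (p q r : k)
    (X1 X2 X3 Y1 Y2 Y3 Z1 Z2 Z3 : k)
    (hind : ∀ s t m : k, s * Z1 + t * X1 + m * Y1 = 0 → s * Z2 + t * X2 + m * Y2 = 0 →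
      s * Z3 + t * X3 + m * Y3 = 0 → s = 0 ∧ t = 0 ∧ m = 0)
    (c : k) (hc : c = a * Y1 ^ 2 + b * Y2 ^ 2 - a * b * Y3 ^ 2)
    (e3 : a * X1 * Y1 + b * X2 * Y2 - a * b * X3 * Y3 = 0)
    (e2 : (a * X1 ^ 2 + b * X2 ^ 2 - a * b * X3 ^ 2)
      + 2 * (a * Y1 * Z1 + b * Y2 * Z2 - a * b * Y3 * Z3) = p * c)
    (e1 : 2 * (a * X1 * Z1 + b * X2 * Z2 - a * b * X3 * Z3) = q * c)
    (e0 : a * Z1 ^ 2 + b * Z2 ^ 2 - a * b * Z3 ^ 2 = r * c) :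
    ∃ lam : k, lam ≠ 0 ∧ lam ^ 3 + 2 * p * lam ^ 2 + (p ^ 2 - 4 * r) * lam - q ^ 2 ≠ 0 ∧
      Nonempty (ℍ[k, a, b] ≃ₐ[k]
        ℍ[k, lam, -(lam ^ 3 + 2 * p * lam ^ 2 + (p ^ 2 - 4 * r) * lam - q ^ 2)]) := by
  have hc0 : c ≠ 0 := by
    intro h
    obtain ⟨h1, h2, h3⟩ := aniso_coords hA Y1 Y2 Y3 (by rw [← hc, h])
    have := hind 0 0 1 (by simp [h1]) (by simp [h2]) (by simp [h3])
    simp at this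
  obtain ⟨lam, hlam⟩ : ∃ lam, a * X1 ^ 2 + b * X2 ^ 2 - a * b * X3 ^ 2 = -lam * c :=
    ⟨-(a * X1 ^ 2 + b * X2 ^ 2 - a * b * X3 ^ 2) / c, by field_simp⟩
  have hl0 : lam ≠ 0 := by
    rintro rfl
    obtain ⟨h1, h2, h3⟩ := aniso_coords hA X1 X2 X3 (by rw [hlam]; simp)
    have := hind 0 1 0 (by simp [h1]) (by simp [h2]) (by simp [h3])
    simp at this
  obtain ⟨s, hs⟩ : ∃ s, s = q / (2 * lam) := ⟨_, rfl⟩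
  obtain ⟨t, ht⟩ : ∃ t, t = -(p + lam) / 2 := ⟨_, rfl⟩
  have hs' : 2 * lam * s = q := by rw [hs]; field_simp
  have ht' : 2 * t = -(p + lam) := by rw [ht]; field_simp
  obtain ⟨R, hR⟩ : ∃ R, R = lam ^ 3 + 2 * p * lam ^ 2 + (p ^ 2 - 4 * r) * lam - q ^ 2 := ⟨_, rfl⟩
  have hq : a * (Z1 + s * X1 + t * Y1) ^ 2 + b * (Z2 + s * X2 + t * Y2) ^ 2
      - a * b * (Z3 + s * X3 + t * Y3) ^ 2 = -(c * R) / (2 * 2 * lam) := by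
    rw [eq_div_iff (by simp [h2, hl0]), hR]
    linear_combination 4 * lam * e0 + 4 * lam * s * e1 + 4 * lam * t * e2 + 8 * lam * s * t * e3
      + 4 * lam * (s ^ 2 - t) * hlam - 4 * lam * t ^ 2 * hc - c * (2 * lam * s - q) * hs'
      + c * lam * (2 * t + p + lam) * ht'
  have hR0 : R ≠ 0 := by
    rintro rfl
    obtain ⟨h1, h2, h3⟩ := aniso_coords hA _ _ _ (hq.trans (by simp))
    have := hind 1 s t (by simpa using h1) (by simpa using h2) (by simpa using h3)
    simp at this
  refine ⟨lam, hl0, hR ▸ hR0, ?_⟩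
  rw [← hR]
  obtain ⟨e⟩ := triple h2 (A := ℍ[k, a, b]) (QuaternionAlgebra.finrank_eq_four _ _ _)
    ⟨0, X1, X2, X3⟩ ⟨0, Y1, Y2, Y3⟩ ⟨0, Z1 + s * X1 + t * Y1, Z2 + s * X2 + t * Y2,
      Z3 + s * X3 + t * Y3⟩ c lam R hc0 hl0 hR0 (by rw [pure_sq, hlam]) (by rw [pure_sq, hc])
      (by rw [pure_sq, hq]) (pure_anti _ _ _ _ _ _ (by linear_combination e3))
      (pure_anti _ _ _ _ _ _ (by
        apply mul_left_cancel₀ h2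
        linear_combination e1 + 2 * t * e3 + 2 * s * hlam - c * hs'))
      (pure_anti _ _ _ _ _ _ (by
        apply mul_left_cancel₀ h2
        linear_combination e2 - hlam + 2 * s * e3 - 2 * t * hc + c * ht'))
  exact ⟨e.symm⟩

theorem indep_case {k : Type} [Field k] (h2 : (2 : k) ≠ 0) {L : Type} [Field L] [Algebra k L]
    (hdeg : Module.finrank k L = 4) (x : L) (p q r : k)
    (hx : x ^ 4 + algebraMap k L p * x ^ 2 + algebraMap k L q * x + algebraMap k L r = 0)
    (hxi : LinearIndependent k ![1, x, x ^ 2, x ^ 3]) {a b : k}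
    (hA : ∀ h : ℍ[k, a, b], h * h = 0 → h = 0) (v : Fin 3 → L)
    (hv : LinearIndependent k v)
    (hq : algebraMap k L a * v 0 ^ 2 + algebraMap k L b * v 1 ^ 2
      - algebraMap k L a * algebraMap k L b * v 2 ^ 2 = 0) :
    ∃ lam : k, lam ≠ 0 ∧ lam ^ 3 + 2 * p * lam ^ 2 + (p ^ 2 - 4 * r) * lam - q ^ 2 ≠ 0 ∧
      Nonempty (ℍ[k, a, b] ≃ₐ[k]
        ℍ[k, lam, -(lam ^ 3 + 2 * p * lam ^ 2 + (p ^ 2 - 4 * r) * lam - q ^ 2)]) := by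
  have hfin : Module.Finite k L := Module.finite_of_finrank_pos (by omega)
  let B : Module.Basis (Fin 4) k L := basisOfLinearIndependentOfCardEqFinrank hxi (by simp [hdeg])
  have hB : ∀ y : L, y = algebraMap k L (B.repr y 0) + algebraMap k L (B.repr y 1) * x
      + algebraMap k L (B.repr y 2) * x ^ 2 + algebraMap k L (B.repr y 3) * x ^ 3 := by
    intro y
    conv_lhs => rw [← B.sum_repr y]
    simp [Fin.sum_univ_four, B, Algebra.smul_def]
  let T : L →ₗ[k] (Fin 3 → k) :=
    LinearMap.pi fun i => (B.coord 3) ∘ₗ (LinearMap.mulRight k (v i))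
  have hT := LinearMap.ker_ne_bot_of_finrank_lt (f := T) (by simp [hdeg])
  obtain ⟨z, hzk, hz⟩ := (Submodule.ne_bot_iff _).1 hT
  have hz3 : ∀ i, B.repr (z * v i) 3 = 0 := fun i => congrFun (LinearMap.mem_ker.1 hzk) i
  let M : Matrix (Fin 3) (Fin 4) k := fun i j => B.repr (z * v i) j
  have hM : ∀ i, z * v i = algebraMap k L (M i 0) + algebraMap k L (M i 1) * x
      + algebraMap k L (M i 2) * x ^ 2 := by
    intro i
    have := hB (z * v i)
    rw [hz3 i, (algebraMap k L).map_zero, zero_mul, add_zero] at this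
    exact this
  have hdet : (Matrix.of ![![M 0 0, M 0 1, M 0 2], ![M 1 0, M 1 1, M 1 2],
      ![M 2 0, M 2 1, M 2 2]]).det ≠ 0 := by
    intro h
    obtain ⟨g, hg, hgm⟩ := Matrix.exists_vecMul_eq_zero_iff.2 h
    apply hg
    have g0 := congrArg (algebraMap k L) (congrFun hgm 0)
    have g1 := congrArg (algebraMap k L) (congrFun hgm 1)
    have g2 := congrArg (algebraMap k L) (congrFun hgm 2)
    simp [Matrix.vecMul, dotProduct, Fin.sum_univ_three] at g0 g1 g2
    have hlin : ∑ i, g i • v i = 0 := by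
      apply mul_left_cancel₀ hz
      simp only [Fin.sum_univ_three, Algebra.smul_def]
      linear_combination g0 + x * g1 + x ^ 2 * g2 + algebraMap k L (g 0) * hM 0
        + algebraMap k L (g 1) * hM 1 + algebraMap k L (g 2) * hM 2
    funext i
    exact Fintype.linearIndependent_iff.1 hv g hlin i
  have hx4 : ∀ c0 c1 c2 c3 : k, algebraMap k L c0 + algebraMap k L c1 * x + algebraMap k L c2 * x ^ 2
      + algebraMap k L c3 * x ^ 3 = 0 → c0 = 0 ∧ c1 = 0 ∧ c2 = 0 ∧ c3 = 0 := by
    intro c0 c1 c2 c3 h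
    have := Fintype.linearIndependent_iff.1 hxi ![c0, c1, c2, c3]
      (by simpa [Fin.sum_univ_four, Algebra.smul_def] using h)
    exact ⟨this 0, this 1, this 2, this 3⟩
  have hmain := hx4
    (a * M 0 0 ^ 2 + b * M 1 0 ^ 2 - a * b * M 2 0 ^ 2
      - r * (a * M 0 2 ^ 2 + b * M 1 2 ^ 2 - a * b * M 2 2 ^ 2))
    (2 * (a * M 0 1 * M 0 0 + b * M 1 1 * M 1 0 - a * b * M 2 1 * M 2 0)
      - q * (a * M 0 2 ^ 2 + b * M 1 2 ^ 2 - a * b * M 2 2 ^ 2))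
    ((a * M 0 1 ^ 2 + b * M 1 1 ^ 2 - a * b * M 2 1 ^ 2)
      + 2 * (a * M 0 2 * M 0 0 + b * M 1 2 * M 1 0 - a * b * M 2 2 * M 2 0)
      - p * (a * M 0 2 ^ 2 + b * M 1 2 ^ 2 - a * b * M 2 2 ^ 2))
    (2 * (a * M 0 1 * M 0 2 + b * M 1 1 * M 1 2 - a * b * M 2 1 * M 2 2)) (by
      have h1 : algebraMap k L a * (z * v 0) ^ 2 + algebraMap k L b * (z * v 1) ^ 2
        - algebraMap k L a * algebraMap k L b * (z * v 2) ^ 2 = 0 := by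
        linear_combination z ^ 2 * hq
      rw [hM, hM, hM] at h1
      simp only [map_add, map_mul, map_sub, map_pow, map_ofNat]
      linear_combination h1 - (algebraMap k L a * algebraMap k L (M 0 2) ^ 2
        + algebraMap k L b * algebraMap k L (M 1 2) ^ 2
        - algebraMap k L a * algebraMap k L b * algebraMap k L (M 2 2) ^ 2) * hx)
  obtain ⟨f0, f1, f2, f3⟩ := hmain
  refine final_step h2 hA p q r (M 0 1) (M 1 1) (M 2 1) (M 0 2) (M 1 2) (M 2 2)
    (M 0 0) (M 1 0) (M 2 0) ?_ _ rfl ?_ ?_ ?_ ?_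
  · intro s t m h1 h2 h3
    by_contra hne
    apply hdet
    refine Matrix.exists_mulVec_eq_zero_iff.1 ⟨![s, t, m], ?_, ?_⟩
    · intro h
      exact hne ⟨congrFun h 0, congrFun h 1, congrFun h 2⟩
    · funext i
      fin_cases i
      · simp [Matrix.mulVec, dotProduct, Fin.sum_univ_three]; linear_combination h1
      · simp [Matrix.mulVec, dotProduct, Fin.sum_univ_three]; linear_combination h2
      · simp [Matrix.mulVec, dotProduct, Fin.sum_univ_three]; linear_combination h3
  · simpa [h2] using f3
  · linear_combination f2
  · linear_combination f1
  · linear_combination f0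

theorem exists_scale {k : Type} [Field k] [Infinite k] (t : k) : ∃ g : k, g ≠ 0 ∧ t * g ^ 4 ≠ 1 := by
  by_contra hcon
  push Not at hcon
  have hP : (X * (C t * X ^ 4 - 1) : k[X]) = 0 := by
    apply Polynomial.funext
    intro g
    by_cases hg : g = 0
    · simp [hg]
    · simp [hcon g hg]
  have := congrArg (fun P : k[X] => P.coeff 1) hP
  rw [show (1 : ℕ) = 0 + 1 from rfl] at this
  simp only [coeff_X_mul] at this
  simp at this

theorem dep_two {k : Type} [Field k] [Infinite k] (h2 : (2 : k) ≠ 0) {L : Type} [Field L] [Algebra k L]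
    (hdeg : Module.finrank k L = 4) {δ b : k}
    (hA : ∀ h : ℍ[k, δ, b], h * h = 0 → h = 0) (D : L) (hD : D ^ 2 = algebraMap k L δ) :
    ∃ v : Fin 3 → L, LinearIndependent k v ∧ algebraMap k L δ * v 0 ^ 2 + algebraMap k L b * v 1 ^ 2
      - algebraMap k L δ * algebraMap k L b * v 2 ^ 2 = 0 := by
  have hfin : Module.Finite k L := Module.finite_of_finrank_pos (by omega)
  have hb : b ≠ 0 := by
    rintro rfl
    have := aniso_coords hA 0 1 0 (by simp)
    simp at this
  have hL2 : (2 : L) ≠ 0 := by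
    intro h
    apply h2
    apply (algebraMap k L).injective
    rw [map_ofNat, map_zero, h]
  have hDk : ∀ s : k, D ≠ algebraMap k L s := by
    rintro s rfl
    rw [← map_pow] at hD
    have hs := (algebraMap k L).injective hD
    have := aniso_coords hA 0 s 1 (by rw [← hs]; ring)
    simp at this
  have h1D : ∀ c d : k, algebraMap k L c + algebraMap k L d * D = 0 → c = 0 ∧ d = 0 := by
    intro c d h
    have hd : d = 0 := by
      by_contra hd
      apply hDk (-c / d)
      have hd' : algebraMap k L d ≠ 0 := by simpa using hd
      rw [map_div₀, map_neg, eq_div_iff hd']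
      linear_combination h
    subst hd
    simpa using h
  obtain ⟨y, hy⟩ : ∃ y : L, ∀ c d : k, y ≠ algebraMap k L c + algebraMap k L d * D := by
    by_contra hcon
    push Not at hcon
    let T : (Fin 2 → k) →ₗ[k] L := Fintype.linearCombination k ![1, D]
    have hT : Function.Surjective T := by
      intro y
      obtain ⟨c, d, h⟩ := hcon y
      exact ⟨![c, d], by simp [T, Fintype.linearCombination_apply, Fin.sum_univ_two, Algebra.smul_def, h]⟩
    have := LinearMap.finrank_le_finrank_of_surjective hT
    simp [hdeg] at this
  have h4 : ∀ c0 c1 c2 c3 : k, algebraMap k L c0 + algebraMap k L c1 * D +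
      (algebraMap k L c2 + algebraMap k L c3 * D) * y = 0 → c0 = 0 ∧ c1 = 0 ∧ c2 = 0 ∧ c3 = 0 := by
    intro c0 c1 c2 c3 h
    have h23 : algebraMap k L c2 + algebraMap k L c3 * D = 0 := by
      by_contra hne
      have hne' : algebraMap k L c2 + algebraMap k L (-c3) * D ≠ 0 := by
        intro h0
        obtain ⟨f1, f2⟩ := h1D _ _ h0
        apply hne
        simp [f1, neg_eq_zero.1 f2]
      have hn : algebraMap k L (c2 ^ 2 - δ * c3 ^ 2) =
          (algebraMap k L c2 + algebraMap k L c3 * D) * (algebraMap k L c2 + algebraMap k L (-c3) * D) := by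
        simp only [map_sub, map_mul, map_pow, map_neg]
        linear_combination algebraMap k L c3 ^ 2 * hD
      have hn0 : algebraMap k L (c2 ^ 2 - δ * c3 ^ 2) ≠ 0 := by
        rw [hn]; exact mul_ne_zero hne hne'
      apply hy (-(c0 * c2 - c1 * c3 * δ) / (c2 ^ 2 - δ * c3 ^ 2)) (-(c1 * c2 - c0 * c3) / (c2 ^ 2 - δ * c3 ^ 2))
      apply mul_left_cancel₀ hn0
      rw [map_div₀, map_div₀, mul_add, mul_div_cancel₀ _ hn0, ← mul_assoc, mul_div_cancel₀ _ hn0, hn]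
      simp only [map_sub, map_mul, map_neg]
      linear_combination (algebraMap k L c2 - algebraMap k L c3 * D) * h
        + algebraMap k L c1 * algebraMap k L c3 * hD
    rw [h23, zero_mul, add_zero] at h
    exact ⟨(h1D _ _ h).1, (h1D _ _ h).2, (h1D _ _ h23).1, (h1D _ _ h23).2⟩
  have hli : LinearIndependent k ![1, D, y, D * y] := by
    rw [Fintype.linearIndependent_iff]
    intro g hg
    simp [Fin.sum_univ_four, Algebra.smul_def] at hg
    obtain ⟨f0, f1, f2, f3⟩ := h4 (g 0) (g 1) (g 2) (g 3) (by linear_combination hg)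
    intro i
    fin_cases i <;> assumption
  let B : Module.Basis (Fin 4) k L := basisOfLinearIndependentOfCardEqFinrank hli (by simp [hdeg])
  obtain ⟨c0, c1, c2, c3, hyy⟩ : ∃ c0 c1 c2 c3 : k, y ^ 2 = algebraMap k L c0 + algebraMap k L c1 * D
      + (algebraMap k L c2 + algebraMap k L c3 * D) * y := by
    refine ⟨B.repr (y ^ 2) 0, B.repr (y ^ 2) 1, B.repr (y ^ 2) 2, B.repr (y ^ 2) 3, ?_⟩
    conv_lhs => rw [← B.sum_repr (y ^ 2)]
    simp [Fin.sum_univ_four, B, Algebra.smul_def]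
    ring
  -- complete the square
  obtain ⟨m, e0, e1, hm, hmi⟩ : ∃ (m : L) (e0 e1 : k), m ^ 2 = algebraMap k L e0 + algebraMap k L e1 * D ∧
      ∀ c d f : k, algebraMap k L c + algebraMap k L d * D + algebraMap k L f * m = 0 →
        c = 0 ∧ d = 0 ∧ f = 0 := by
    refine ⟨y - algebraMap k L (c2 / 2) - algebraMap k L (c3 / 2) * D, c0 + (c2 ^ 2 + c3 ^ 2 * δ) / 4,
      c1 + c2 * c3 / 2, ?_, ?_⟩
    · have h4L : (4 : L) ≠ 0 := by
        rw [show (4 : L) = 2 * 2 by norm_num]; exact mul_ne_zero hL2 hL2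
      simp only [map_div₀, map_add, map_mul, map_pow, map_ofNat]
      field_simp
      linear_combination 16 * hyy + 4 * algebraMap k L c3 ^ 2 * hD
    · intro c d f h
      obtain ⟨f0, f1, f2, f3⟩ := h4 (c - f * (c2 / 2)) (d - f * (c3 / 2)) f 0 (by
        simp only [map_sub, map_mul, map_zero]
        linear_combination h)
      subst f2
      simp at f0 f1
      exact ⟨f0, f1, rfl⟩
  obtain ⟨g, hg0, hg⟩ := exists_scale (b ^ 2 * (e0 ^ 2 - δ * e1 ^ 2))
  let G := algebraMap k L g
  let b' := algebraMap k L b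
  refine ⟨![2 * b' * (G * m), D * (1 - b' * (G * m) ^ 2), 1 + b' * (G * m) ^ 2], ?_, ?_⟩
  · rw [Fintype.linearIndependent_iff]
    intro c hc
    simp only [Fin.sum_univ_three, Algebra.smul_def, Matrix.cons_val] at hc
    obtain ⟨f0, f1, f2⟩ := hmi (-c 1 * b * g ^ 2 * e1 * δ + c 2 * (1 + b * g ^ 2 * e0))
      (c 1 * (1 - b * g ^ 2 * e0) + c 2 * b * g ^ 2 * e1) (c 0 * 2 * b * g) (by
        simp only [map_sub, map_add, map_mul, map_neg, map_pow, map_ofNat, map_one]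
        simp only [G, b'] at hc
        linear_combination hc + (D * algebraMap k L (c 1) - algebraMap k L (c 2)) * b' * G ^ 2 * hm
          + algebraMap k L (c 1) * b' * G ^ 2 * algebraMap k L e1 * hD)
    have hc0 : c 0 = 0 := by simpa [h2, hb, hg0] using f2
    have hdet : b ^ 2 * (e0 ^ 2 - δ * e1 ^ 2) * g ^ 4 - 1 ≠ 0 := sub_ne_zero.2 hg
    have hc1 : c 1 = 0 := by
      apply (mul_eq_zero.1 (?_ : (b ^ 2 * (e0 ^ 2 - δ * e1 ^ 2) * g ^ 4 - 1) * c 1 = 0)).resolve_left hdet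
      linear_combination b * g ^ 2 * e1 * f0 - (1 + b * g ^ 2 * e0) * f1
    have hc2 : c 2 = 0 := by
      apply (mul_eq_zero.1 (?_ : (b ^ 2 * (e0 ^ 2 - δ * e1 ^ 2) * g ^ 4 - 1) * c 2 = 0)).resolve_left hdet
      linear_combination -(1 - b * g ^ 2 * e0) * f0 - b * g ^ 2 * e1 * δ * f1
    intro i
    fin_cases i <;> assumption
  · simp only [Matrix.cons_val]
    rw [← hD]
    ring

theorem exists_sqrt {k : Type} [Field k] {L : Type} [Field L] [Algebra k L] {a b : k}
    (ha : a ≠ 0) (hb : b ≠ 0) (n0 n1 n2 : k) (v0 v1 v2 : L)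
    (hv : ¬ (v0 = 0 ∧ v1 = 0 ∧ v2 = 0))
    (hn : algebraMap k L n0 * v0 + algebraMap k L n1 * v1 + algebraMap k L n2 * v2 = 0)
    (hq : algebraMap k L a * v0 ^ 2 + algebraMap k L b * v1 ^ 2
      - algebraMap k L a * algebraMap k L b * v2 ^ 2 = 0) :
    ∃ D : L, D ^ 2 = algebraMap k L (n0 ^ 2 / a + n1 ^ 2 / b - n2 ^ 2 / (a * b)) := by
  simp only [map_sub, map_add, map_div₀, map_pow, map_mul]
  have ha' : algebraMap k L a ≠ 0 := by simpa using ha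
  have hb' : algebraMap k L b ≠ 0 := by simpa using hb
  generalize algebraMap k L a = A at *
  generalize algebraMap k L b = B at *
  generalize algebraMap k L n0 = N0 at *
  generalize algebraMap k L n1 = N1 at *
  generalize algebraMap k L n2 = N2 at *
  by_cases h0 : v0 = 0
  · subst h0
    have h12 : v1 ^ 2 = A * v2 ^ 2 := by
      apply mul_left_cancel₀ hb'
      linear_combination hq
    have hv2 : v2 ≠ 0 := by
      rintro rfl
      apply hv
      simpa using h12
    have hv1 : v1 ≠ 0 := by
      rintro rfl
      have : A * v2 ^ 2 = 0 := by linear_combination -h12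
      simp [ha', hv2] at this
    have hN : A * N1 ^ 2 = N2 ^ 2 := by
      apply mul_right_cancel₀ (pow_ne_zero 2 hv2)
      linear_combination -N1 ^ 2 * h12 + (N1 * v1 - N2 * v2) * hn
    refine ⟨N0 * v2 / v1, ?_⟩
    rw [div_pow, mul_pow, h12, ← hN]
    field_simp
    ring
  · refine ⟨(-N1 * v2 - N2 * v1 / A) / v0, ?_⟩
    rw [div_pow, div_eq_iff (pow_ne_zero 2 h0)]
    linear_combination (norm := (field_simp; ring)) -((N0 * v0 - N1 * v1 - N2 * v2) / A) * hn
      - ((N1 ^ 2 / B - N2 ^ 2 / (A * B)) / A) * hq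

theorem dep_case {k : Type} [Field k] [Infinite k] (h2 : (2 : k) ≠ 0) {L : Type} [Field L] [Algebra k L]
    (hdeg : Module.finrank k L = 4) {a b : k} (ha : a ≠ 0) (hb : b ≠ 0)
    (hA : ∀ h : ℍ[k, a, b], h * h = 0 → h = 0) (v : Fin 3 → L) (hv0 : v ≠ 0)
    (hv : ¬ LinearIndependent k v)
    (hq : algebraMap k L a * v 0 ^ 2 + algebraMap k L b * v 1 ^ 2
      - algebraMap k L a * algebraMap k L b * v 2 ^ 2 = 0) :
    ∃ a' b' : k, Nonempty (ℍ[k, a', b'] ≃ₐ[k] ℍ[k, a, b]) ∧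
      ∃ v' : Fin 3 → L, LinearIndependent k v' ∧ algebraMap k L a' * v' 0 ^ 2
        + algebraMap k L b' * v' 1 ^ 2 - algebraMap k L a' * algebraMap k L b' * v' 2 ^ 2 = 0 := by
  obtain ⟨n, hn, i, hi⟩ := Fintype.not_linearIndependent_iff.1 hv
  simp only [Fin.sum_univ_three, Algebra.smul_def] at hn
  have hn0 : ¬ (n 0 = 0 ∧ n 1 = 0 ∧ n 2 = 0) := by
    rintro ⟨h0, h1, h2⟩
    fin_cases i <;> exact hi ‹_›
  obtain ⟨D, hD⟩ := exists_sqrt ha hb (n 0) (n 1) (n 2) (v 0) (v 1) (v 2) (by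
    rintro ⟨h0, h1, h2⟩
    apply hv0
    funext i
    fin_cases i <;> assumption) hn hq
  obtain ⟨e1, e2, e3, he, hne⟩ : ∃ e1 e2 e3 : k, ¬ (e1 = 0 ∧ e2 = 0 ∧ e3 = 0) ∧
      n 0 * e1 + n 1 * e2 + n 2 * e3 = 0 := by
    by_cases h : n 0 = 0 ∧ n 1 = 0
    · exact ⟨1, 0, 0, by simp, by simp [h]⟩
    · exact ⟨n 1, -n 0, 0, by simpa [and_comm] using h, by ring⟩
  set δ := n 0 ^ 2 / a + n 1 ^ 2 / b - n 2 ^ 2 / (a * b) with hδ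
  have hδ' : a * (n 0 / a) ^ 2 + b * (n 1 / b) ^ 2 - a * b * (-n 2 / (a * b)) ^ 2 = δ := by
    rw [hδ]; field_simp
  have hδ0 : δ ≠ 0 := by
    intro h
    have := aniso_coords hA _ _ _ (hδ'.trans h)
    apply hn0
    simpa [ha, hb] using this
  have hb0 : a * e1 ^ 2 + b * e2 ^ 2 - a * b * e3 ^ 2 ≠ 0 := fun h => he (aniso_coords hA _ _ _ h)
  have hiso := iso_of_basis h2 hδ0 hb0 (A := ℍ[k, a, b]) (QuaternionAlgebra.finrank_eq_four _ _ _)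
    ⟨0, n 0 / a, n 1 / b, -n 2 / (a * b)⟩ ⟨0, e1, e2, e3⟩ (by rw [pure_sq, hδ']) (by rw [pure_sq])
    (pure_anti _ _ _ _ _ _ (by
      field_simp
      linear_combination hne))
  refine ⟨_, _, hiso, ?_⟩
  obtain ⟨e⟩ := hiso
  refine dep_two h2 hdeg (fun h hh => ?_) D hD
  have := hA (e h) (by rw [← map_mul, hh, map_zero])
  simpa using this

theorem nonsplit_case {k : Type} [Field k] [Infinite k] (h2 : (2 : k) ≠ 0) {L : Type} [Field L] [Algebra k L]
    (hdeg : Module.finrank k L = 4) (x : L) (p q r : k)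
    (hx : x ^ 4 + algebraMap k L p * x ^ 2 + algebraMap k L q * x + algebraMap k L r = 0)
    (hxi : LinearIndependent k ![1, x, x ^ 2, x ^ 3]) {a b : k} (ha : a ≠ 0) (hb : b ≠ 0)
    (hA : ∀ h : ℍ[k, a, b], h * h = 0 → h = 0) (v : Fin 3 → L) (hv0 : v ≠ 0)
    (hq : algebraMap k L a * v 0 ^ 2 + algebraMap k L b * v 1 ^ 2
      - algebraMap k L a * algebraMap k L b * v 2 ^ 2 = 0) :
    ∃ lam : k, lam ≠ 0 ∧ lam ^ 3 + 2 * p * lam ^ 2 + (p ^ 2 - 4 * r) * lam - q ^ 2 ≠ 0 ∧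
      Nonempty (ℍ[k, a, b] ≃ₐ[k]
        ℍ[k, lam, -(lam ^ 3 + 2 * p * lam ^ 2 + (p ^ 2 - 4 * r) * lam - q ^ 2)]) := by
  by_cases hv : LinearIndependent k v
  · exact indep_case h2 hdeg x p q r hx hxi hA v hv hq
  · obtain ⟨a', b', ⟨e⟩, v', hv', hq'⟩ := dep_case h2 hdeg ha hb hA v hv0 hv hq
    obtain ⟨lam, h1, h3, ⟨e'⟩⟩ := indep_case h2 hdeg x p q r hx hxi (a := a') (b := b') (fun h hh => by
      have := hA (e h) (by rw [← map_mul, hh, map_zero])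
      simpa using this) v' hv' hq'
    exact ⟨lam, h1, h3, ⟨e.symm.trans e'⟩⟩

theorem coeffs_quartic {K : Type} [Field K] (g : K[X]) (a b c d : K)
    (h : g = C a + C b * X + C c * X ^ 2 + C d * X ^ 3 + X ^ 4) :
    g.coeff 0 = a ∧ g.coeff 1 = b ∧ g.coeff 2 = c ∧ g.coeff 3 = d := by
  subst h
  refine ⟨?_, ?_, ?_, ?_⟩ <;> simp [coeff_X, coeff_C]

theorem setup {k : Type} [Field k] (h2 : (2 : k) ≠ 0) {L : Type} [Field L] [Algebra k L]
    (l : L) (hgen : IntermediateField.adjoin k {l} = ⊤) (hdeg : Module.finrank k L = 4)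
    (l1 l2 l3 l4 : AlgebraicClosure k)
    (hroots : (minpoly k l).aroots (AlgebraicClosure k) = {l1, l2, l3, l4}) :
    ∃ (x : L) (p q r : k),
      x ^ 4 + algebraMap k L p * x ^ 2 + algebraMap k L q * x + algebraMap k L r = 0 ∧
      LinearIndependent k ![1, x, x ^ 2, x ^ 3] ∧
      ∀ t : AlgebraicClosure k,
        t ^ 3 + 2 * algebraMap k _ p * t ^ 2
          + ((algebraMap k _ p) ^ 2 - 4 * algebraMap k _ r) * t - (algebraMap k _ q) ^ 2
        = (t - (l1 + l2 - l3 - l4) ^ 2 / 4) * (t - (l1 - l2 + l3 - l4) ^ 2 / 4)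
          * (t - (l1 - l2 - l3 + l4) ^ 2 / 4) := by
  have h4 : (4 : k) ≠ 0 := by
    have : (4 : k) = 2 * 2 := by norm_num
    rw [this]; exact mul_ne_zero h2 h2
  have : FiniteDimensional k L := Module.finite_of_finrank_pos (by omega)
  have hint : IsIntegral k l := IsIntegral.of_finite k l
  have hnd : (minpoly k l).natDegree = 4 := by
    rw [(Field.primitive_element_iff_minpoly_natDegree_eq k l).1 hgen, hdeg]
  have hmon := minpoly.monic hint
  obtain ⟨f, hf⟩ : ∃ f, f = minpoly k l := ⟨_, rfl⟩
  have hc4 : f.coeff 4 = 1 := by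
    rw [hf, ← hnd]; exact hmon
  obtain ⟨u, hu⟩ : ∃ u, u = f.coeff 3 / 4 := ⟨_, rfl⟩
  have hu' : f.coeff 3 = 4 * u := by rw [hu]; field_simp
  have hfx : f = C (f.coeff 0) + C (f.coeff 1) * X + C (f.coeff 2) * X ^ 2
      + C (4 * u) * X ^ 3 + X ^ 4 := by
    conv_lhs => rw [f.as_sum_range_C_mul_X_pow, hf, hnd, ← hf]
    simp [Finset.sum_range_succ, hc4, hu']
  have hl : l ^ 4 + algebraMap k L (4 * u) * l ^ 3 + algebraMap k L (f.coeff 2) * l ^ 2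
      + algebraMap k L (f.coeff 1) * l + algebraMap k L (f.coeff 0) = 0 := by
    have := minpoly.aeval k l
    rw [← hf, hfx] at this
    simp only [map_add, aeval_C, aeval_X, map_mul, map_pow] at this ⊢
    linear_combination this
  have hprod : f.map (algebraMap k (AlgebraicClosure k)) =
      (X - C l1) * ((X - C l2) * ((X - C l3) * (X - C l4))) := by
    have h := (IsAlgClosed.splits (f.map (algebraMap k (AlgebraicClosure k)))).eq_prod_roots_of_monic
      (by rw [hf]; exact hmon.map _)
    rw [hf] at h ⊢
    change _ = (Multiset.map _ ((minpoly k l).aroots (AlgebraicClosure k))).prod at h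
    rw [h, hroots]
    simp
  have hexp : (X - C l1) * ((X - C l2) * ((X - C l3) * (X - C l4))) =
      C (l1 * l2 * l3 * l4) + C (-(l1*l2*l3 + l1*l2*l4 + l1*l3*l4 + l2*l3*l4)) * X
      + C (l1*l2+l1*l3+l1*l4+l2*l3+l2*l4+l3*l4) * X ^ 2 + C (-(l1+l2+l3+l4)) * X ^ 3 + X ^ 4 := by
    simp only [C_add, C_mul, C_neg]; ring
  rw [hexp] at hprod
  obtain ⟨e0, e1, e2, e3⟩ := coeffs_quartic _ _ _ _ _ hprod
  simp only [coeff_map, hu', map_mul, map_ofNat] at e0 e1 e2 e3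
  refine ⟨l + algebraMap k L u, f.coeff 2 - 6 * u ^ 2, f.coeff 1 - 2 * f.coeff 2 * u + 8 * u ^ 3,
    f.coeff 0 - f.coeff 1 * u + f.coeff 2 * u ^ 2 - 3 * u ^ 4, ?_, ?_, ?_⟩
  · simp only [map_add, map_sub, map_mul, map_pow, map_ofNat] at hl ⊢
    linear_combination hl
  · have hnx : (minpoly k (l + algebraMap k L u)).natDegree = 4 := by
      rw [minpoly.add_algebraMap, natDegree_comp, hnd]; simp
    have := linearIndependent_pow (K := k) (l + algebraMap k L u)
    have h' := (linearIndependent_equiv (finCongr hnx.symm)).2 this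
    convert h' using 1
    funext i
    fin_cases i <;> simp
  · intro t
    have h4' : (4 : AlgebraicClosure k) ≠ 0 := by
      have := (map_ne_zero (algebraMap k (AlgebraicClosure k))).2 h4
      rwa [map_ofNat] at this
    simp only [map_add, map_sub, map_mul, map_pow, map_ofNat]
    rw [e0, e1, e2]
    generalize algebraMap k (AlgebraicClosure k) u = U at *
    have hl4 : l4 = -4 * U - l1 - l2 - l3 := by linear_combination e3
    have t1 : (l1 + l2 - l3 - l4) ^ 2 / 4 = (l1 + l2 + 2 * U) ^ 2 := by
      rw [hl4, div_eq_iff h4']; ring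
    have t2 : (l1 - l2 + l3 - l4) ^ 2 / 4 = (l1 + l3 + 2 * U) ^ 2 := by
      rw [hl4, div_eq_iff h4']; ring
    have t3 : (l1 - l2 - l3 + l4) ^ 2 / 4 = (l2 + l3 + 2 * U) ^ 2 := by
      rw [hl4, div_eq_iff h4']; ring
    rw [t1, t2, t3, hl4]
    ring

theorem exists_good {k K : Type} [Field k] [Field K] [Algebra k K] (h2 : (2 : k) ≠ 0) (p q r : k)
    (hq : q ≠ 0)
    (θ₁ θ₂ θ₃ : K) (h12 : θ₁ ≠ θ₂) (h13 : θ₁ ≠ θ₃) (h23 : θ₂ ≠ θ₃)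
    (h : ∀ t : K, t ^ 3 + 2 * algebraMap k _ p * t ^ 2
          + ((algebraMap k _ p) ^ 2 - 4 * algebraMap k _ r) * t - (algebraMap k _ q) ^ 2
        = (t - θ₁) * (t - θ₂) * (t - θ₃)) :
    ∃ lam : k, lam ≠ 0 ∧ lam ^ 3 + 2 * p * lam ^ 2 + (p ^ 2 - 4 * r) * lam - q ^ 2 ≠ 0 := by
  by_contra hcon
  push Not at hcon
  have c1 := hcon 1 one_ne_zero
  have c2 := hcon (-1) (by simp)
  have c3 := hcon (q ^ 2) (pow_ne_zero _ hq)
  have d1 : 2 * p = q ^ 2 := mul_left_cancel₀ h2 (by linear_combination c1 + c2)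
  have d2 : p ^ 2 - 4 * r = -1 := mul_left_cancel₀ h2 (by linear_combination c1 - c2)
  have d3 : q ^ 4 = 1 := by
    have : 2 * q ^ 2 ≠ 0 := mul_ne_zero h2 (pow_ne_zero _ hq)
    refine mul_left_cancel₀ this ?_
    rw [d1, d2] at c3
    linear_combination c3
  have D1 := congrArg (algebraMap k K) d1
  have D2 := congrArg (algebraMap k K) d2
  have D3 := congrArg (algebraMap k K) d3
  simp only [map_mul, map_sub, map_pow, map_ofNat, map_one, map_neg] at D1 D2 D3
  rw [D1, D2] at h
  generalize algebraMap k K q = s at *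
  have key : ∀ t : K, (t ^ 2 - 1) * (t + s ^ 2) = (t - θ₁) * (t - θ₂) * (t - θ₃) := by
    intro t; rw [← h]; ring
  have hs : ∀ t : K, (t ^ 2 - 1) * (t + s ^ 2) = 0 → t ^ 2 = 1 := by
    intro t ht
    rcases mul_eq_zero.1 ht with h' | h'
    · linear_combination h'
    · have : t = - s ^ 2 := by linear_combination h'
      rw [this]; linear_combination D3
  have a1 := hs θ₁ (by rw [key]; ring)
  have a2 := hs θ₂ (by rw [key]; ring)
  have a3 := hs θ₃ (by rw [key]; ring)
  rcases sq_eq_sq_iff_eq_or_eq_neg.1 (a1.trans a2.symm) with e | e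
  · exact h12 e
  rcases sq_eq_sq_iff_eq_or_eq_neg.1 (a1.trans a3.symm) with e' | e'
  · exact h13 e'
  exact h23 (neg_injective (e.symm.trans e'))

theorem finite_norm {k : Type} [Field k] [Finite k] (h2 : (2 : k) ≠ 0) (a b : k) (ha : a ≠ 0) :
    ∃ A B : k, b = A ^ 2 - a * B ^ 2 := by
  have := Fintype.ofFinite k
  have hch : ringChar k ≠ 2 := by
    intro h
    apply h2
    have := ringChar.Nat.cast_ringChar (R := k)
    rw [h] at this
    exact_mod_cast this
  obtain ⟨A, B, h⟩ := FiniteField.exists_root_sum_quadratic (R := k) (f := X ^ 2 - C b)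
    (g := C (-a) * X ^ 2) (degree_X_pow_sub_C (by norm_num) _)
    (by rw [degree_C_mul_X_pow 2 (neg_ne_zero.2 ha)]; rfl)
    (FiniteField.odd_card_of_char_ne_two hch)
  refine ⟨A, B, ?_⟩
  simp at h
  linear_combination -h

theorem finite_iso {k : Type} [Field k] [Finite k] (h2 : (2 : k) ≠ 0) {a b c d : k} (ha : a ≠ 0)
    (hb : b ≠ 0) (hc : c ≠ 0) (hd : d ≠ 0) : Nonempty (ℍ[k, a, b] ≃ₐ[k] ℍ[k, c, d]) := by
  obtain ⟨A, B, h⟩ := finite_norm h2 a b ha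
  obtain ⟨A', B', h'⟩ := finite_norm h2 c d hc
  obtain ⟨e⟩ := iso_matrix h2 ha hb A B h
  obtain ⟨e'⟩ := iso_matrix h2 hc hd A' B' h'
  exact ⟨e.trans e'.symm⟩

theorem forward {k : Type} [Field k] (h2 : (2 : k) ≠ 0) {L : Type} [Field L] [Algebra k L]
    (hdeg : Module.finrank k L = 4) (x : L) (p q r : k)
    (hx : x ^ 4 + algebraMap k L p * x ^ 2 + algebraMap k L q * x + algebraMap k L r = 0)
    (hxi : LinearIndependent k ![1, x, x ^ 2, x ^ 3])
    (hgood : ∃ lam : k, lam ≠ 0 ∧ lam ^ 3 + 2 * p * lam ^ 2 + (p ^ 2 - 4 * r) * lam - q ^ 2 ≠ 0)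
    (hq : q ≠ 0) {a b : k} (ha : a ≠ 0) (hb : b ≠ 0)
    (e : Nonempty ((L ⊗[k] ℍ[k, a, b]) ≃ₐ[L] Matrix (Fin 2) (Fin 2) L)) :
    ∃ lam : k, lam ≠ 0 ∧ lam ^ 3 + 2 * p * lam ^ 2 + (p ^ 2 - 4 * r) * lam - q ^ 2 ≠ 0 ∧
      Nonempty (ℍ[k, a, b] ≃ₐ[k]
        ℍ[k, lam, -(lam ^ 3 + 2 * p * lam ^ 2 + (p ^ 2 - 4 * r) * lam - q ^ 2)]) := by
  rcases finite_or_infinite k with hfin | hinf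
  · obtain ⟨lam, h1, h3⟩ := hgood
    exact ⟨lam, h1, h3, finite_iso h2 ha hb h1 (neg_ne_zero.2 h3)⟩
  by_cases hA : ∀ h : ℍ[k, a, b], h * h = 0 → h = 0
  · obtain ⟨e⟩ := e
    obtain ⟨e'⟩ := baseChange L a b
    obtain ⟨h, hh, h0⟩ := split_isotropic ⟨e'.symm.trans e⟩
    have h2' : (2 : L) ≠ 0 := by
      have := (map_ne_zero (algebraMap k L)).2 h2
      rwa [map_ofNat] at this
    obtain ⟨hre, hform⟩ := sq_zero_coords h2' h hh
    refine nonsplit_case h2 hdeg x p q r hx hxi ha hb hA ![h.imI, h.imJ, h.imK] ?_ (by simpa using hform)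
    intro hv
    apply h0
    have v0 := congrFun hv 0
    have v1 := congrFun hv 1
    have v2 := congrFun hv 2
    simp at v0 v1 v2
    ext <;> simp [hre, v0, v1, v2]
  · push Not at hA
    obtain ⟨h, hh, h0⟩ := hA
    obtain ⟨e1⟩ := split_of_isotropic h2 ha hb h hh h0
    obtain ⟨c, hc⟩ : ∃ c : k, c * ((c ^ 2) ^ 3 + 2 * p * (c ^ 2) ^ 2 + (p ^ 2 - 4 * r) * (c ^ 2) - q ^ 2) ≠ 0 := by
      by_contra hcon
      push Not at hcon
      have hz : (X * ((X ^ 2) ^ 3 + C (2 * p) * (X ^ 2) ^ 2 + C (p ^ 2 - 4 * r) * (X ^ 2)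
          - C (q ^ 2)) : k[X]) = 0 := by
        apply Polynomial.funext
        intro c
        simpa using hcon c
      have := (mul_eq_zero.1 hz).resolve_left X_ne_zero
      have := congrArg (eval 0) this
      simp at this
      exact hq this
    have hc0 : c ≠ 0 := left_ne_zero_of_mul hc
    have hR := right_ne_zero_of_mul hc
    refine ⟨c ^ 2, pow_ne_zero _ hc0, hR, ?_⟩
    generalize (c ^ 2) ^ 3 + 2 * p * (c ^ 2) ^ 2 + (p ^ 2 - 4 * r) * (c ^ 2) - q ^ 2 = R at *
    obtain ⟨e2⟩ := iso_matrix h2 (pow_ne_zero 2 hc0) (neg_ne_zero.2 hR) ((1 - R) / 2)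
      ((1 + R) / (2 * c)) (by field_simp; ring)
    exact ⟨e1.trans e2.symm⟩

theorem backward {k : Type} [Field k] (h2 : (2 : k) ≠ 0) {L : Type} [Field L] [Algebra k L]
    (x : L) (p q r : k)
    (hx : x ^ 4 + algebraMap k L p * x ^ 2 + algebraMap k L q * x + algebraMap k L r = 0)
    {a b : k} (lam : k) (hl : lam ≠ 0)
    (hR : lam ^ 3 + 2 * p * lam ^ 2 + (p ^ 2 - 4 * r) * lam - q ^ 2 ≠ 0)
    (e : Nonempty (ℍ[k, a, b] ≃ₐ[k]
        ℍ[k, lam, -(lam ^ 3 + 2 * p * lam ^ 2 + (p ^ 2 - 4 * r) * lam - q ^ 2)])) :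
    Nonempty ((L ⊗[k] ℍ[k, a, b]) ≃ₐ[L] Matrix (Fin 2) (Fin 2) L) := by
  obtain ⟨e⟩ := e
  have h2' : (2 : L) ≠ 0 := by
    have := (map_ne_zero (algebraMap k L)).2 h2
    rwa [map_ofNat] at this
  obtain ⟨e1⟩ := baseChange L lam (-(lam ^ 3 + 2 * p * lam ^ 2 + (p ^ 2 - 4 * r) * lam - q ^ 2))
  obtain ⟨e2⟩ := iso_matrix h2' ((map_ne_zero (algebraMap k L)).2 hl)
    ((map_ne_zero (algebraMap k L)).2 (neg_ne_zero.2 hR))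
    (algebraMap k L q - 2 * algebraMap k L lam * x)
    (algebraMap k L lam + algebraMap k L p + 2 * x ^ 2) (by
      simp only [map_add, map_sub, map_mul, map_pow, map_ofNat, map_neg]
      linear_combination (4 * algebraMap k L lam) * hx)
  exact ⟨((Algebra.TensorProduct.congr AlgEquiv.refl e).trans e1).trans e2⟩

end S17

/-- Let `k` be a field of characteristic `≠ 2` and `L = k(ℓ)` a separable quartic field
extension, with `ℓ₁, ℓ₂, ℓ₃, ℓ₄` the roots of the minimal polynomial of `ℓ` in an algebraic
closure, and `ρ ∈ k[X]` the monic resolvent cubic with roots `¼(ℓ₁+ℓ₂−ℓ₃−ℓ₄)²`,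
`¼(ℓ₁−ℓ₂+ℓ₃−ℓ₄)²`, `¼(ℓ₁−ℓ₂−ℓ₃+ℓ₄)²`, assumed to be generic (the six sums `ℓᵢ+ℓⱼ` are
pairwise distinct and `ρ` has distinct roots). A quaternion `k`-algebra `Q = (α, β)_k` is
split by `L` if and only if `Q ≅ (λ, −ρ(λ))_k` for some `λ ∈ k^×` with `ρ(λ) ≠ 0`. -/
theorem statement17 (k : Type) [Field k] (hchar : (2 : k) ≠ 0)
    (L : Type) [Field L] [Algebra k L] [Algebra.IsSeparable k L]
    (ℓ : L) (hgen : IntermediateField.adjoin k {ℓ} = ⊤)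
    (hdeg : Module.finrank k L = 4)
    (ℓ₁ ℓ₂ ℓ₃ ℓ₄ : AlgebraicClosure k)
    (hroots : (minpoly k ℓ).aroots (AlgebraicClosure k) = {ℓ₁, ℓ₂, ℓ₃, ℓ₄})
    (hdist : ([ℓ₁, ℓ₂, ℓ₃, ℓ₄] : List (AlgebraicClosure k)).Pairwise (· ≠ ·))
    (ρ : Polynomial k) (hmonic : ρ.Monic)
    (hρ : ρ.map (algebraMap k (AlgebraicClosure k)) =
      (X - C ((ℓ₁ + ℓ₂ - ℓ₃ - ℓ₄) ^ 2 / 4)) *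
      (X - C ((ℓ₁ - ℓ₂ + ℓ₃ - ℓ₄) ^ 2 / 4)) *
      (X - C ((ℓ₁ - ℓ₂ - ℓ₃ + ℓ₄) ^ 2 / 4)))
    (hsums : ([ℓ₁ + ℓ₂, ℓ₁ + ℓ₃, ℓ₁ + ℓ₄, ℓ₂ + ℓ₃, ℓ₂ + ℓ₄, ℓ₃ + ℓ₄] :
      List (AlgebraicClosure k)).Pairwise (· ≠ ·))
    (hres : ([(ℓ₁ + ℓ₂ - ℓ₃ - ℓ₄) ^ 2 / 4, (ℓ₁ - ℓ₂ + ℓ₃ - ℓ₄) ^ 2 / 4,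
      (ℓ₁ - ℓ₂ - ℓ₃ + ℓ₄) ^ 2 / 4] : List (AlgebraicClosure k)).Pairwise (· ≠ ·))
    (α β : k) (hα : α ≠ 0) (hβ : β ≠ 0) :
    Nonempty ((L ⊗[k] ℍ[k, α, β]) ≃ₐ[L] Matrix (Fin 2) (Fin 2) L) ↔
      ∃ lam : k, lam ≠ 0 ∧ ρ.eval lam ≠ 0 ∧
        Nonempty (ℍ[k, α, β] ≃ₐ[k] ℍ[k, lam, -ρ.eval lam]) := by
  obtain ⟨x, p, q, r, hx, hxi, hres3⟩ := S17.setup hchar ℓ hgen hdeg ℓ₁ ℓ₂ ℓ₃ ℓ₄ hroots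
  have h4' : (4 : AlgebraicClosure k) ≠ 0 := by
    have h := (map_ne_zero (algebraMap k (AlgebraicClosure k))).2 (mul_ne_zero hchar hchar)
    rw [map_mul, map_ofNat] at h
    norm_num at h
    exact h
  have hev : ∀ lam : k, ρ.eval lam = lam ^ 3 + 2 * p * lam ^ 2 + (p ^ 2 - 4 * r) * lam - q ^ 2 := by
    intro lam
    apply (algebraMap k (AlgebraicClosure k)).injective
    have h := congrArg (eval (algebraMap k (AlgebraicClosure k) lam)) hρ
    rw [eval_map_apply] at h
    rw [h]
    simp only [map_add, map_sub, map_mul, map_pow, map_ofNat, eval_mul, eval_sub, eval_X, eval_C]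
    exact (hres3 _).symm
  simp only [List.pairwise_cons, List.mem_cons, List.not_mem_nil, or_false, forall_eq_or_imp,
    forall_eq] at hsums hres
  have hq : q ≠ 0 := by
    intro hq
    have h := hres3 0
    rw [hq] at h
    simp only [map_zero] at h
    have hz : (ℓ₁ + ℓ₂ - ℓ₃ - ℓ₄) ^ 2 / 4 * ((ℓ₁ - ℓ₂ + ℓ₃ - ℓ₄) ^ 2 / 4)
        * ((ℓ₁ - ℓ₂ - ℓ₃ + ℓ₄) ^ 2 / 4) = 0 := by
      linear_combination h
    rcases mul_eq_zero.1 hz with hz | hz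
    · rcases mul_eq_zero.1 hz with hz | hz
      · have hz := pow_eq_zero_iff (two_ne_zero) |>.1 ((div_eq_zero_iff.1 hz).resolve_right h4')
        exact hsums.1.2.2.2.2 (by linear_combination hz)
      · have hz := pow_eq_zero_iff (two_ne_zero) |>.1 ((div_eq_zero_iff.1 hz).resolve_right h4')
        exact hsums.2.1.2.2.1 (by linear_combination hz)
    · have hz := pow_eq_zero_iff (two_ne_zero) |>.1 ((div_eq_zero_iff.1 hz).resolve_right h4')
      exact hsums.2.2.1.1 (by linear_combination hz)
  have hgood := S17.exists_good hchar p q r hq _ _ _ hres.1.1 hres.1.2 hres.2.1 hres3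
  constructor
  · intro e
    obtain ⟨lam, h1, h3, e'⟩ := S17.forward hchar hdeg x p q r hx hxi hgood hq hα hβ e
    rw [← hev] at h3 e'
    exact ⟨lam, h1, h3, e'⟩
  · rintro ⟨lam, h1, h3, e⟩
    rw [hev] at h3 e
    exact S17.backward hchar x p q r hx lam h1 h3 e
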